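/- arXiv:2504.07847 — 8 statements merged into one kernel-verified Lean document; each statement's English description precedes it below -/
import Mathlib

section
/- Let P be an n×n real symmetric positive semidefinite matrix with P ≠ 0. Then the map θ ↦ γ(P, θ) is strictly increasing on [0, 1/σ_max(P)): for all θ₁, θ₂ with 0 ≤ θ₁ < θ₂ < 1/σ_max(P), one has γ(P, θ₁) < γ(P, θ₂). In particular γ(P, 0) = 0 and γ(P, θ) > 0 for every θ ∈ (0, 1/σ_max(P)). -/
open Matrix

/-- The largest eigenvalue (spectral value) of a real matrix. -/
noncomputable def sigmaMax {n : ℕ} (P : Matrix (Fin n) (Fin n) ℝ) : ℝ :=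
  sSup (spectrum ℝ P)

/-- γ(P, θ) = ½ (log det (I − θP) + tr ((I − θP)⁻¹) − n). -/
noncomputable def gammaFn {n : ℕ} (P : Matrix (Fin n) (Fin n) ℝ) (θ : ℝ) : ℝ :=
  (1 / 2) * (Real.log ((1 - θ • P).det) + ((1 - θ • P)⁻¹).trace - (n : ℝ))

theorem Real.log_add_inv_lt_log_add_inv {x y : ℝ} (hy : 0 < y) (hyx : y < x) (hx : x ≤ 1) :
    Real.log x + x⁻¹ < Real.log y + y⁻¹ := by
  have hx0 : 0 < x := hy.trans hyx
  have hlog : Real.log (x / y) < x / y - 1 :=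
    Real.log_lt_sub_one_of_pos (div_pos hx0 hy) ((one_lt_div hy).2 hyx).ne'
  rw [Real.log_div hx0.ne' hy.ne'] at hlog
  have hinv : x / y - 1 ≤ y⁻¹ - x⁻¹ := by
    have h : y⁻¹ - x⁻¹ - (x / y - 1) = (x - y) * (1 - x) / (x * y) := by
      field_simp
    have : 0 ≤ (x - y) * (1 - x) / (x * y) :=
      div_nonneg (mul_nonneg (by linarith) (by linarith)) (by positivity)
    linarith
  linarith

theorem Matrix.IsHermitian.exists_unitary_one_sub_smul {n : ℕ} {P : Matrix (Fin n) (Fin n) ℝ}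
    (hP : P.IsHermitian) :
    ∃ U V : Matrix (Fin n) (Fin n) ℝ, U * V = 1 ∧ V * U = 1 ∧
      ∀ θ : ℝ, 1 - θ • P = U * diagonal (fun i => 1 - θ * hP.eigenvalues i) * V := by
  have hUV := Unitary.mul_star_self_of_mem hP.eigenvectorUnitary.2
  refine ⟨_, _, hUV, Unitary.star_mul_self_of_mem hP.eigenvectorUnitary.2, fun θ => ?_⟩
  have hd : diagonal (fun i => 1 - θ * hP.eigenvalues i) =
      1 - θ • diagonal hP.eigenvalues := by
    ext i j
    by_cases h : i = j <;> simp [h]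
  have hs : P = hP.eigenvectorUnitary * diagonal hP.eigenvalues *
      (star hP.eigenvectorUnitary : Matrix (Fin n) (Fin n) ℝ) := by
    simpa [Unitary.conjStarAlgAut_apply, Function.comp_def] using hP.spectral_theorem
  rw [hd, mul_sub, sub_mul, mul_one, hUV, mul_smul_comm, smul_mul_assoc]
  exact congrArg (fun M => 1 - θ • M) hs

theorem gammaFn_eq_sum {n : ℕ} {P : Matrix (Fin n) (Fin n) ℝ} (hP : P.IsHermitian) {θ : ℝ}
    (hθ : ∀ i, 0 < 1 - θ * hP.eigenvalues i) :
    gammaFn P θ = (1 / 2) * ((∑ i, (Real.log (1 - θ * hP.eigenvalues i) +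
      (1 - θ * hP.eigenvalues i)⁻¹)) - (n : ℝ)) := by
  obtain ⟨U, V, hUV, hVU, h⟩ := hP.exists_unitary_one_sub_smul
  have hdet : (1 - θ • P).det = ∏ i, (1 - θ * hP.eigenvalues i) := by
    rw [h, det_mul_comm, ← mul_assoc, hVU, one_mul, det_diagonal]
  have hinv : (1 - θ • P)⁻¹ = U * diagonal (fun i => (1 - θ * hP.eigenvalues i)⁻¹) * V := by
    apply inv_eq_right_inv
    have hdiag : diagonal (fun i => 1 - θ * hP.eigenvalues i) *
        diagonal (fun i => (1 - θ * hP.eigenvalues i)⁻¹) = 1 := by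
      rw [diagonal_mul_diagonal, ← diagonal_one]
      exact congrArg diagonal (funext fun i => mul_inv_cancel₀ (hθ i).ne')
    rw [h, mul_assoc U _ V, mul_assoc U _ V, mul_assoc U, mul_assoc _ V, ← mul_assoc V, hVU,
      one_mul, ← mul_assoc _ _ V, hdiag, one_mul, hUV]
  have htr : ((1 - θ • P)⁻¹).trace = ∑ i, (1 - θ * hP.eigenvalues i)⁻¹ := by
    rw [hinv, trace_mul_comm, ← mul_assoc, hVU, one_mul, trace_diagonal]
  rw [gammaFn, hdet, htr, Real.log_prod (fun i _ => (hθ i).ne'), Finset.sum_add_distrib]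

theorem Matrix.IsHermitian.eigenvalues_le_sigmaMax {n : ℕ} {P : Matrix (Fin n) (Fin n) ℝ}
    (hP : P.IsHermitian) (i : Fin n) : hP.eigenvalues i ≤ sigmaMax P :=
  le_csSup P.finite_real_spectrum.bddAbove (hP.eigenvalues_mem_spectrum_real i)

theorem Matrix.PosSemidef.one_sub_mul_eigenvalues_pos {n : ℕ} {P : Matrix (Fin n) (Fin n) ℝ}
    (hP : P.PosSemidef) {θ : ℝ} (h0 : 0 ≤ θ) (hθ : θ < 1 / sigmaMax P) (i : Fin n) :
    0 < 1 - θ * hP.isHermitian.eigenvalues i := by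
  have hσ : 0 < sigmaMax P := one_div_pos.1 (h0.trans_lt hθ)
  have h1 := mul_le_mul_of_nonneg_left (hP.isHermitian.eigenvalues_le_sigmaMax i) h0
  have h2 := (lt_div_iff₀ hσ).1 hθ
  linarith

theorem stmt_0 {n : ℕ} (hn : 0 < n) (P : Matrix (Fin n) (Fin n) ℝ)
    (hsym : P.IsSymm) (hpsd : P.PosSemidef) (hne : P ≠ 0) :
    (∀ θ₁ θ₂ : ℝ, 0 ≤ θ₁ → θ₁ < θ₂ → θ₂ < 1 / sigmaMax P →
      gammaFn P θ₁ < gammaFn P θ₂) ∧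
    gammaFn P 0 = 0 ∧
    (∀ θ : ℝ, 0 < θ → θ < 1 / sigmaMax P → 0 < gammaFn P θ) := by
  have hP := hpsd.isHermitian
  have hmono : ∀ θ₁ θ₂ : ℝ, 0 ≤ θ₁ → θ₁ < θ₂ → θ₂ < 1 / sigmaMax P →
      gammaFn P θ₁ < gammaFn P θ₂ := by
    intro θ₁ θ₂ h0 h12 h2
    have hpos₁ := hpsd.one_sub_mul_eigenvalues_pos h0 (h12.trans h2)
    have hpos₂ := hpsd.one_sub_mul_eigenvalues_pos (h0.trans h12.le) h2
    have hlt : ∀ i, 0 < hP.eigenvalues i →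
        Real.log (1 - θ₁ * hP.eigenvalues i) + (1 - θ₁ * hP.eigenvalues i)⁻¹ <
          Real.log (1 - θ₂ * hP.eigenvalues i) + (1 - θ₂ * hP.eigenvalues i)⁻¹ := by
      intro i hi
      refine Real.log_add_inv_lt_log_add_inv (hpos₂ i) ?_ ?_
      · linarith [mul_lt_mul_of_pos_right h12 hi]
      · linarith [mul_nonneg h0 hi.le]
    obtain ⟨j, hj⟩ : ∃ j, hP.eigenvalues j ≠ 0 := by
      by_contra! h
      exact hne (hP.eigenvalues_eq_zero_iff.1 (funext h))
    rw [gammaFn_eq_sum hP hpos₁, gammaFn_eq_sum hP hpos₂]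
    have hsum := Finset.sum_lt_sum (s := Finset.univ)
      (fun i _ => (hpsd.eigenvalues_nonneg i).eq_or_lt.elim
        (fun h => by simp [← h]) (fun h => (hlt i h).le))
      ⟨j, Finset.mem_univ j, hlt j ((hpsd.eigenvalues_nonneg j).lt_of_ne' hj)⟩
    linarith
  have hzero : gammaFn P 0 = 0 := by simp [gammaFn]
  exact ⟨hmono, hzero, fun θ h0 hθ => hzero ▸ hmono 0 θ le_rfl h0 hθ⟩
end

section
/- Let X be an n×n real symmetric positive definite matrix and Y an n×n real symmetric positive semidefinite matrix with Y ⪯ X (i.e. X − Y positive semidefinite), and let θ satisfy 0 ≤ θ < 1/σ_max(X). Then both I − θX and I − θY are positive definite and γ(Y, θ) ≤ γ(X, θ). -/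
open Matrix

namespace Matrix

variable {m : Type*} [Fintype m] [DecidableEq m]

lemma PosSemidef.exists_eq_conjTranspose_mul_self {P : Matrix m m ℝ} (hP : P.PosSemidef) :
    ∃ C : Matrix m m ℝ, P = Cᴴ * C := by
  open scoped MatrixOrder in
  exact CStarAlgebra.nonneg_iff_eq_star_mul_self.mp hP.nonneg

lemma PosSemidef.trace_mul_nonneg {P Q : Matrix m m ℝ} (hP : P.PosSemidef) (hQ : Q.PosSemidef) :
    0 ≤ (P * Q).trace := by
  obtain ⟨C, rfl⟩ := hP.exists_eq_conjTranspose_mul_self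
  rw [Matrix.mul_assoc, trace_mul_comm]
  exact (hQ.mul_mul_conjTranspose_same C).trace_nonneg

lemma PosDef.log_det_le_trace_sub_card {M : Matrix m m ℝ} (hM : M.PosDef) :
    Real.log M.det ≤ M.trace - Fintype.card m := by
  have hdet : M.det = ∏ i, hM.isHermitian.eigenvalues i := by
    simpa using hM.isHermitian.det_eq_prod_eigenvalues
  have htr : M.trace = ∑ i, hM.isHermitian.eigenvalues i := by
    simpa using hM.isHermitian.trace_eq_sum_eigenvalues
  rw [hdet, htr, Real.log_prod fun i _ => (hM.eigenvalues_pos i).ne']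
  calc ∑ i, Real.log (hM.isHermitian.eigenvalues i)
      ≤ ∑ i, (hM.isHermitian.eigenvalues i - 1) :=
        Finset.sum_le_sum fun i _ => Real.log_le_sub_one_of_pos (hM.eigenvalues_pos i)
    _ = _ := by simp

lemma PosDef.log_det_sub_log_det_le {A B : Matrix m m ℝ} (hA : A.PosDef) (hB : B.PosDef) :
    Real.log B.det - Real.log A.det ≤ (B * A⁻¹).trace - Fintype.card m := by
  obtain ⟨C, hC⟩ := hB.posSemidef.exists_eq_conjTranspose_mul_self
  have hdetC : C.det ≠ 0 := by
    intro h
    have := hB.det_pos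
    simp [hC, h] at this
  have hM : (C * A⁻¹ * Cᴴ).PosDef :=
    hA.inv.mul_mul_conjTranspose_same <| vecMul_injective_of_isUnit <|
      (isUnit_iff_isUnit_det C).2 hdetC.isUnit
  have hdet : (C * A⁻¹ * Cᴴ).det = B.det / A.det := by
    rw [hC]
    simp only [det_mul, det_nonsing_inv, Ring.inverse_eq_inv']
    ring
  have htr : (C * A⁻¹ * Cᴴ).trace = (B * A⁻¹).trace := by
    rw [hC, trace_mul_comm, Matrix.mul_assoc]
  have := hM.log_det_le_trace_sub_card
  rwa [hdet, htr, Real.log_div hB.det_pos.ne' hA.det_pos.ne'] at this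

lemma PosDef.posSemidef_inv_sub_inv {A B : Matrix m m ℝ} (hA : A.PosDef) (hB : B.PosDef)
    (hAB : (B - A).PosSemidef) : (A⁻¹ - B⁻¹).PosSemidef := by
  have hAu := (isUnit_iff_isUnit_det A).1 hA.isUnit
  have hBu := (isUnit_iff_isUnit_det B).1 hB.isUnit
  have hsub : A⁻¹ - B⁻¹ = B⁻¹ * (B - A) * A⁻¹ := by
    rw [Matrix.mul_sub, Matrix.sub_mul, nonsing_inv_mul B hBu, Matrix.mul_assoc,
      mul_nonsing_inv A hAu, Matrix.one_mul, Matrix.mul_one]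
  have hsub' : A⁻¹ - B⁻¹ = A⁻¹ * (B - A) * B⁻¹ := by
    rw [Matrix.mul_sub, Matrix.sub_mul, nonsing_inv_mul A hAu, Matrix.mul_assoc,
      mul_nonsing_inv B hBu, Matrix.one_mul, Matrix.mul_one]
  have key : A⁻¹ - B⁻¹ = B⁻¹ * (B - A) * (B⁻¹)ᴴ
      + (B⁻¹ * (B - A)) * A⁻¹ * (B⁻¹ * (B - A))ᴴ := by
    rw [conjTranspose_mul, hB.inv.isHermitian.eq, hAB.isHermitian.eq]
    calc A⁻¹ - B⁻¹ = B⁻¹ * (B - A) * (B⁻¹ + (A⁻¹ - B⁻¹)) := by rw [add_sub_cancel, ← hsub]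
      _ = _ := by rw [hsub']; noncomm_ring
  rw [key]
  exact (hAB.mul_mul_conjTranspose_same _).add
    (hA.inv.posSemidef.mul_mul_conjTranspose_same _)

/-- On `0 < M ≤ 1`, the map `M ↦ log det M + tr M⁻¹` is antitone in the Loewner order. -/
lemma PosDef.log_det_add_trace_inv_le {A B : Matrix m m ℝ} (hA : A.PosDef) (hB : B.PosDef)
    (hAB : (B - A).PosSemidef) (hB1 : (1 - B).PosSemidef) :
    Real.log B.det + B⁻¹.trace ≤ Real.log A.det + A⁻¹.trace := by
  have hlog := hA.log_det_sub_log_det_le hB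
  have htr := hB1.trace_mul_nonneg (hA.posSemidef_inv_sub_inv hB hAB)
  rw [Matrix.sub_mul, Matrix.one_mul, Matrix.mul_sub,
    mul_nonsing_inv B ((isUnit_iff_isUnit_det B).1 hB.isUnit), trace_sub, trace_sub, trace_sub,
    trace_one] at htr
  linarith

lemma IsHermitian.posDef_one_sub_smul {X : Matrix m m ℝ} (hX : X.IsHermitian) {θ : ℝ}
    (hθ0 : 0 ≤ θ) (hθ : θ < 1 / sSup (spectrum ℝ X)) : (1 - θ • X).PosDef := by
  rcases hθ0.eq_or_lt with rfl | hpos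
  · simpa using PosDef.one
  have hσ : 0 < sSup (spectrum ℝ X) := one_div_pos.1 (hpos.trans hθ)
  have hH : (1 - θ • X).IsHermitian := isHermitian_one.sub (hX.smul (IsSelfAdjoint.all θ))
  rw [hH.posDef_iff_eigenvalues_pos]
  intro i
  have hmem := hH.eigenvalues_mem_spectrum_real i
  set μ := hH.eigenvalues i
  have hmem' : (1 - μ) / θ ∈ spectrum ℝ X := by
    rw [spectrum.mem_iff] at hmem ⊢
    contrapose! hmem
    have heq : algebraMap ℝ (Matrix m m ℝ) μ - (1 - θ • X)
        = (-θ) • (algebraMap ℝ (Matrix m m ℝ) ((1 - μ) / θ) - X) := by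
      simp only [Algebra.algebraMap_eq_smul_one, smul_sub, smul_smul]
      rw [show -θ * ((1 - μ) / θ) = μ - 1 by field_simp; ring, sub_smul, one_smul, neg_smul]
      abel
    rw [heq]
    exact hmem.smul (Units.mk0 (-θ) (neg_ne_zero.2 hpos.ne'))
  have hle := le_csSup X.finite_real_spectrum.bddAbove hmem'
  rw [div_le_iff₀ hpos] at hle
  rw [lt_div_iff₀ hσ] at hθ
  linarith

end Matrix

theorem stmt_1 {n : ℕ} (X Y : Matrix (Fin n) (Fin n) ℝ)
    (hXsym : X.IsSymm) (hX : X.PosDef)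
    (hYsym : Y.IsSymm) (hY : Y.PosSemidef)
    (hYX : (X - Y).PosSemidef)
    (θ : ℝ) (hθ0 : 0 ≤ θ) (hθ : θ < 1 / sigmaMax X) :
    ((1 : Matrix (Fin n) (Fin n) ℝ) - θ • X).PosDef ∧
    ((1 : Matrix (Fin n) (Fin n) ℝ) - θ • Y).PosDef ∧
    gammaFn Y θ ≤ gammaFn X θ := by
  have hA := hX.isHermitian.posDef_one_sub_smul hθ0 hθ
  have hAB : ((1 - θ • Y) - (1 - θ • X)).PosSemidef := by
    rw [sub_sub_sub_cancel_left, ← smul_sub]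
    exact hYX.smul hθ0
  have hB : (1 - θ • Y).PosDef := by
    simpa using hA.add_posSemidef hAB
  refine ⟨hA, hB, ?_⟩
  have h := hA.log_det_add_trace_inv_le hB hAB (by simpa using hY.smul hθ0)
  unfold gammaFn
  linarith
end

section
/- Let P̄ and P be n×n real symmetric matrices with P̄ positive definite and P̄ ⪯ P. Let θ and φ satisfy 0 ≤ θ < 1/σ_max(P) and 0 ≤ φ < 1/σ_max(P̄). If γ(P, θ) ≤ γ(P̄, φ), then θ ≤ φ. -/
open Matrix

open scoped MatrixOrder

namespace Matrix

variable {m : Type*} [Fintype m] [DecidableEq m]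

theorem PosDef.exists_isUnit_conjTranspose_mul_self {A : Matrix m m ℝ} (hA : A.PosDef) :
    ∃ C : Matrix m m ℝ, IsUnit C ∧ A = Cᴴ * C := by
  obtain ⟨C, rfl⟩ := CStarAlgebra.nonneg_iff_eq_star_mul_self.mp hA.posSemidef.nonneg
  refine ⟨C, ?_, rfl⟩
  have h := (isUnit_iff_isUnit_det _).mp hA.isUnit
  rw [det_mul] at h
  exact (isUnit_iff_isUnit_det _).mpr (isUnit_of_mul_isUnit_right h)

theorem PosSemidef.trace_mul_nonneg_s4 {A B : Matrix m m ℝ} (hA : A.PosSemidef)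
    (hB : B.PosSemidef) : 0 ≤ (A * B).trace := by
  obtain ⟨C, rfl⟩ := CStarAlgebra.nonneg_iff_eq_star_mul_self.mp hB.nonneg
  rw [star_eq_conjTranspose, ← Matrix.mul_assoc, trace_mul_comm, ← Matrix.mul_assoc]
  exact (hA.mul_mul_conjTranspose_same C).trace_nonneg

theorem PosDef.trace_mul_pos [Nonempty m] {A B : Matrix m m ℝ} (hA : A.PosDef)
    (hB : B.PosDef) : 0 < (A * B).trace := by
  obtain ⟨C, hC, rfl⟩ := hB.exists_isUnit_conjTranspose_mul_self
  rw [← Matrix.mul_assoc, trace_mul_comm, ← Matrix.mul_assoc]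
  exact ((IsUnit.posDef_star_right_conjugate_iff hC).mpr hA).trace_pos

/-- Inversion is strictly antitone on positive definite matrices. -/
theorem PosDef.inv_sub_inv {A B : Matrix m m ℝ} (hA : A.PosDef) (hB : B.PosDef)
    (hAB : (B - A).PosDef) : (A⁻¹ - B⁻¹).PosDef := by
  have hA' := (isUnit_iff_isUnit_det _).mp hA.isUnit
  have hB' := (isUnit_iff_isUnit_det _).mp hB.isUnit
  have hBi : IsUnit B⁻¹ := hB.inv.isUnit
  have key : A⁻¹ - B⁻¹ = B⁻¹ * ((B - A) + (B - A) * A⁻¹ * (B - A)) * B⁻¹ := by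
    have h : (B - A) + (B - A) * A⁻¹ * (B - A) = B * (A⁻¹ - B⁻¹) * B := by
      simp only [Matrix.sub_mul, Matrix.mul_sub, mul_nonsing_inv _ hA', mul_nonsing_inv _ hB',
        Matrix.mul_assoc, nonsing_inv_mul _ hA', Matrix.one_mul, Matrix.mul_one]
      abel
    rw [h]
    simp only [Matrix.mul_assoc, mul_nonsing_inv _ hB', Matrix.mul_one]
    rw [nonsing_inv_mul_cancel_left _ _ hB']
  have h1 : ((B - A) * A⁻¹ * (B - A)).PosSemidef := by
    have := hA.inv.posSemidef.mul_mul_conjTranspose_same (B - A)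
    rwa [hAB.isHermitian.eq] at this
  have h2 := (IsUnit.posDef_star_left_conjugate_iff hBi).mpr (hAB.add_posSemidef h1)
  rwa [star_eq_conjTranspose, hB.inv.isHermitian.eq, ← key] at h2

theorem PosDef.log_det_lt {N : Matrix m m ℝ} (hN : N.PosDef)
    (h : (Fintype.card m : ℝ) < N.trace) :
    Real.log N.det < N.trace - Fintype.card m := by
  have htr := hN.isHermitian.trace_eq_sum_eigenvalues
  have hdet := hN.isHermitian.det_eq_prod_eigenvalues
  simp only [RCLike.ofReal_real_eq_id, id_eq] at htr hdet
  have hcard : (Fintype.card m : ℝ) = ∑ _i : m, (1 : ℝ) := by simp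
  rw [hdet, Real.log_prod fun i _ => (hN.eigenvalues_pos i).ne']
  rw [htr, hcard] at h ⊢
  rw [← Finset.sum_sub_distrib]
  obtain ⟨i, hi, hlt⟩ := Finset.exists_lt_of_sum_lt h
  exact Finset.sum_lt_sum
    (fun j _ => Real.log_le_sub_one_of_pos (hN.eigenvalues_pos j))
    ⟨i, hi, Real.log_lt_sub_one_of_pos (hN.eigenvalues_pos i) hlt.ne'⟩

/-- `X ↦ log det X + tr X⁻¹` is strictly decreasing on positive definite contractions. -/
theorem PosDef.log_det_add_trace_inv_lt [Nonempty m] {A B : Matrix m m ℝ} (hA : A.PosDef)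
    (hAB : (B - A).PosDef) (hB1 : (1 - B).PosSemidef) :
    Real.log B.det + B⁻¹.trace < Real.log A.det + A⁻¹.trace := by
  have hB : B.PosDef := by simpa using hA.add hAB
  have hD := hA.inv_sub_inv hB hAB
  have hDB := hD.trace_mul_pos hB
  have hD1 := hD.posSemidef.trace_mul_nonneg_s4 hB1
  have hB' := (isUnit_iff_isUnit_det _).mp hB.isUnit
  obtain ⟨C, hC, hBC⟩ := hB.exists_isUnit_conjTranspose_mul_self
  have hN : (C * A⁻¹ * Cᴴ).PosDef := (IsUnit.posDef_star_right_conjugate_iff hC).mpr hA.inv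
  have htr : (C * A⁻¹ * Cᴴ).trace = (A⁻¹ * B).trace := by
    rw [hBC, ← Matrix.mul_assoc, trace_mul_comm (A⁻¹ * Cᴴ), Matrix.mul_assoc]
  have hdet : (C * A⁻¹ * Cᴴ).det = B.det / A.det := by
    rw [hBC, det_mul, det_mul, det_mul, det_nonsing_inv, Ring.inverse_eq_inv']
    ring
  rw [Matrix.sub_mul, nonsing_inv_mul _ hB', trace_sub, trace_one] at hDB
  rw [Matrix.mul_sub, Matrix.mul_one, Matrix.sub_mul, nonsing_inv_mul _ hB', trace_sub, trace_sub,
    trace_sub, trace_one] at hD1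
  have hlog := hN.log_det_lt (by rw [htr]; linarith)
  rw [hdet, htr, Real.log_div hB.det_pos.ne' hA.det_pos.ne'] at hlog
  linarith

end Matrix

theorem posSemidef_sigmaMax_sub {n : ℕ} {P : Matrix (Fin n) (Fin n) ℝ} (hP : P.IsHermitian) :
    (sigmaMax P • (1 : Matrix (Fin n) (Fin n) ℝ) - P).PosSemidef := by
  refine posSemidef_iff_isHermitian_and_spectrum_nonneg.mpr ⟨?_, ?_⟩
  · exact (isHermitian_one.smul (IsSelfAdjoint.all _)).sub hP
  · rw [← Algebra.algebraMap_eq_smul_one, ← spectrum.singleton_sub_eq]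
    rintro _ ⟨_, rfl, x, hx, rfl⟩
    exact sub_nonneg.mpr (le_csSup P.finite_spectrum.bddAbove hx)

theorem posDef_one_sub_smul {n : ℕ} {P : Matrix (Fin n) (Fin n) ℝ} (hP : P.IsHermitian)
    {θ : ℝ} (hθ0 : 0 ≤ θ) (hθ : θ < 1 / sigmaMax P) : (1 - θ • P).PosDef := by
  have hσ : 0 < sigmaMax P := one_div_pos.mp (hθ0.trans_lt hθ)
  have h : 1 - θ • P = (1 - θ * sigmaMax P) • (1 : Matrix (Fin n) (Fin n) ℝ) +
      θ • (sigmaMax P • (1 : Matrix (Fin n) (Fin n) ℝ) - P) := by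
    module
  rw [h]
  exact (PosDef.one.smul (sub_pos.mpr ((lt_div_iff₀ hσ).mp hθ))).add_posSemidef
    ((posSemidef_sigmaMax_sub hP).smul hθ0)

theorem stmt_4 {n : ℕ} (Pbar P : Matrix (Fin n) (Fin n) ℝ)
    (hPbarsym : Pbar.IsSymm) (hPsym : P.IsSymm) (hPbar : Pbar.PosDef)
    (hle : (P - Pbar).PosSemidef)
    (θ φ : ℝ) (hθ0 : 0 ≤ θ) (hθ : θ < 1 / sigmaMax P)
    (hφ0 : 0 ≤ φ) (hφ : φ < 1 / sigmaMax Pbar)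
    (hγ : gammaFn P θ ≤ gammaFn Pbar φ) :
    θ ≤ φ := by
  by_contra! hlt
  have hP : P.IsHermitian := by simpa using hle.isHermitian.add hPbar.isHermitian
  have : Nonempty (Fin n) := by
    by_contra hn
    rw [not_nonempty_iff] at hn
    rw [sigmaMax, spectrum.of_subsingleton, Real.sSup_empty, div_zero] at hθ
    exact hθ.not_ge hθ0
  have hdiff : ((1 - φ • Pbar) - (1 - θ • P)).PosDef := by
    have h : (1 - φ • Pbar) - (1 - θ • P) = (θ - φ) • Pbar + θ • (P - Pbar) := by module
    rw [h]
    exact (hPbar.smul (sub_pos.mpr hlt)).add_posSemidef (hle.smul hθ0)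
  have hcontr : (1 - (1 - φ • Pbar)).PosSemidef := by
    rw [sub_sub_cancel]
    exact hPbar.posSemidef.smul hφ0
  have := (posDef_one_sub_smul hP hθ0 hθ).log_det_add_trace_inv_lt hdiff hcontr
  unfold gammaFn at hγ
  linarith
end

section
/- Let A and Q be n×n real matrices with Q symmetric, and let M be an n×n real symmetric matrix. Let P and P' be n×n real symmetric positive definite matrices with P ⪯ P' and such that P'⁻¹ + M is positive definite. Then P⁻¹ + M is positive definite and A(P⁻¹ + M)⁻¹Aᵀ + Q ⪯ A(P'⁻¹ + M)⁻¹Aᵀ + Q. -/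
open Matrix

/-- Inversion is antitone on positive definite matrices for the Loewner order. -/
theorem Matrix.PosDef.posSemidef_inv_sub_inv_s5 {m : Type*} [Fintype m] [DecidableEq m]
    {X Y : Matrix m m ℝ} (hX : X.PosDef) (hY : Y.PosDef) (h : (Y - X).PosSemidef) :
    (X⁻¹ - Y⁻¹).PosSemidef := by
  let := hX.isUnit.invertible
  let := hY.isUnit.invertible
  have h₁ := PosDef.fromBlocks₁₁ 1 X⁻¹ hY
  have h₂ := PosDef.fromBlocks₂₂ Y 1 hX.inv
  simp only [conjTranspose_one, Matrix.one_mul, Matrix.mul_one, inv_inv_of_invertible] at h₁ h₂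
  exact h₁.1 (h₂.2 h)

theorem stmt_5 {n : ℕ} (A Q M P P' : Matrix (Fin n) (Fin n) ℝ)
    (hQsym : Q.IsSymm) (hMsym : M.IsSymm)
    (hPsym : P.IsSymm) (hP'sym : P'.IsSymm)
    (hP : P.PosDef) (hP' : P'.PosDef)
    (hle : (P' - P).PosSemidef)
    (hM : (P'⁻¹ + M).PosDef) :
    (P⁻¹ + M).PosDef ∧
    ((A * (P'⁻¹ + M)⁻¹ * Aᵀ + Q) - (A * (P⁻¹ + M)⁻¹ * Aᵀ + Q)).PosSemidef := by
  have hinv := hP.posSemidef_inv_sub_inv_s5 hP' hle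
  have hPM : (P⁻¹ + M).PosDef := by
    simpa only [← add_assoc, sub_add_cancel] using PosDef.posSemidef_add hinv hM
  refine ⟨hPM, ?_⟩
  have hdiff : ((P'⁻¹ + M)⁻¹ - (P⁻¹ + M)⁻¹).PosSemidef :=
    hM.posSemidef_inv_sub_inv_s5 hPM (by simpa using hinv)
  rw [add_sub_add_right_eq_sub, ← Matrix.sub_mul, ← Matrix.mul_sub,
    ← conjTranspose_eq_transpose_of_trivial]
  exact hdiff.mul_mul_conjTranspose_same A
end

section
/- Let W ∈ ℝ^{n×n} be symmetric positive definite, L ∈ ℝ^{n×m} with I_m − LᵀWL positive definite, A ∈ ℝ^{n×n}, C ∈ ℝ^{m×n}. Define O := (I_m − LᵀWL)⁻¹, Ā := (I − LC)A, and F := −O Lᵀ W (I − LC). Then (FA)ᵀ O⁻¹ (FA) + Āᵀ W Ā = Āᵀ (W⁻¹ − LLᵀ)⁻¹ Ā. -/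
open Matrix

/-- Woodbury-type identity for the inverse of `W⁻¹ - L * U`. -/
theorem inv_inv_sub_mul_eq {ι κ R : Type*} [Fintype ι] [DecidableEq ι] [Fintype κ]
    [DecidableEq κ] [CommRing R] {W : Matrix ι ι R} {L : Matrix ι κ R} {U : Matrix κ ι R}
    (hW : IsUnit W.det) (hM : IsUnit (1 - U * W * L).det) :
    (W⁻¹ - L * U)⁻¹ = W + W * L * (1 - U * W * L)⁻¹ * U * W := by
  apply Matrix.inv_eq_right_inv
  have hinv := Matrix.mul_nonsing_inv _ hM
  generalize (1 - U * W * L)⁻¹ = O at hinv ⊢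
  have hO : U * W * L * O = O - 1 := by
    rw [Matrix.sub_mul, Matrix.one_mul] at hinv
    rw [← hinv]
    abel
  calc (W⁻¹ - L * U) * (W + W * L * O * U * W)
      = W⁻¹ * W + (W⁻¹ * W) * (L * O * U * W) - L * U * W - L * (U * W * L * O) * U * W := by
        simp only [Matrix.sub_mul, Matrix.mul_add, Matrix.mul_assoc]
        abel
    _ = 1 := by
        rw [hO, Matrix.nonsing_inv_mul _ hW]
        simp only [Matrix.sub_mul, Matrix.mul_sub, Matrix.one_mul, Matrix.mul_one]
        abel

theorem stmt_10 {n m : ℕ} (W : Matrix (Fin n) (Fin n) ℝ) (hWsym : W.IsSymm) (hW : W.PosDef)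
    (L : Matrix (Fin n) (Fin m) ℝ)
    (hLW : ((1 : Matrix (Fin m) (Fin m) ℝ) - Lᵀ * W * L).PosDef)
    (A : Matrix (Fin n) (Fin n) ℝ) (C : Matrix (Fin m) (Fin n) ℝ)
    (O : Matrix (Fin m) (Fin m) ℝ) (hO : O = (1 - Lᵀ * W * L)⁻¹)
    (Abar : Matrix (Fin n) (Fin n) ℝ) (hAbar : Abar = (1 - L * C) * A)
    (F : Matrix (Fin m) (Fin n) ℝ) (hF : F = -(O * Lᵀ * W * (1 - L * C))) :
    (F * A)ᵀ * O⁻¹ * (F * A) + Abarᵀ * W * Abar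
      = Abarᵀ * (W⁻¹ - L * Lᵀ)⁻¹ * Abar := by
  have hWdet : IsUnit W.det := hW.det_pos.ne'.isUnit
  have hMdet : IsUnit (1 - Lᵀ * W * L).det := hLW.det_pos.ne'.isUnit
  have hWt : Wᵀ = W := hWsym
  have hOt : Oᵀ = O := by
    rw [hO, Matrix.transpose_nonsing_inv]
    simp [Matrix.transpose_mul, hWt, Matrix.mul_assoc]
  have hOdet : IsUnit O.det := by
    rw [hO]
    exact Matrix.isUnit_nonsing_inv_det _ hMdet
  have hFA : F * A = -(O * (Lᵀ * W * Abar)) := by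
    rw [hF, hAbar]
    simp only [Matrix.neg_mul, Matrix.mul_assoc]
  rw [inv_inv_sub_mul_eq hWdet hMdet, ← hO, hFA]
  simp only [Matrix.transpose_neg, Matrix.neg_mul, Matrix.mul_neg, neg_neg,
    Matrix.transpose_mul, Matrix.transpose_transpose, hWt, hOt, Matrix.mul_add, Matrix.add_mul,
    Matrix.mul_assoc, Matrix.nonsing_inv_mul_cancel_left _ _ hOdet]
  exact add_comm _ _
end

section
/- Let A ∈ ℝ^{n×n}, C ∈ ℝ^{m×n}, G ∈ ℝ^{n×m}, and let Q ∈ ℝ^{n×n} and R ∈ ℝ^{m×m} be symmetric positive definite. Let α ∈ (0, 1] and ρ > 1, and let Σ be an n×n real symmetric positive definite matrix satisfying the Lyapunov equation Σ = ρ²(A − αGC)Σ(A − αGC)ᵀ + GRGᵀ + Q. Define β := λ_min(((ρ² − 1)/ρ²)·Σ⁻¹ + (1 − α²)·CᵀR⁻¹C), where λ_min denotes the smallest eigenvalue. Let θ satisfy 0 ≤ θ ≤ β, and let (P_t)_{t≥0} be a sequence of n×n real symmetric matrices with P₀ positive definite, P₀ ⪯ Σ, and P_{t+1} = A(P_t⁻¹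 + CᵀR⁻¹C − θI)⁻¹Aᵀ + Q for all t. Then for every t ≥ 0: P_t is positive definite, P_t ⪯ Σ, and P_t⁻¹ + CᵀR⁻¹C − θI is positive definite (so that V_{t|t} := (P_t⁻¹ + CᵀR⁻¹C − θI)⁻¹ is positive definite). -/
open Matrix

/-- The smallest eigenvalue (spectral value) of a real matrix. -/
noncomputable def lambdaMin {n : ℕ} (M : Matrix (Fin n) (Fin n) ℝ) : ℝ :=
  sInf (spectrum ℝ M)

namespace Matrix

section

variable {ι κ : Type*} [Fintype ι] [Fintype κ]

theorem IsHermitian.dotProduct_mulVec_comm {M : Matrix ι ι ℝ} (hM : M.IsHermitian) (x y : ι → ℝ) :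
    x ⬝ᵥ M *ᵥ y = y ⬝ᵥ M *ᵥ x := by
  have h : Mᵀ = M := by simpa [IsHermitian] using hM
  rw [dotProduct_mulVec, ← mulVec_transpose, h, dotProduct_comm]

theorem dotProduct_mul_mul_transpose_mulVec (E : Matrix ι κ ℝ) (M : Matrix κ κ ℝ) (v : ι → ℝ) :
    v ⬝ᵥ (E * M * Eᵀ) *ᵥ v = (Eᵀ *ᵥ v) ⬝ᵥ M *ᵥ (Eᵀ *ᵥ v) := by
  rw [← mulVec_mulVec, ← mulVec_mulVec, dotProduct_mulVec, ← mulVec_transpose]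

theorem PosSemidef.transpose_mul_mul_same {M : Matrix κ κ ℝ} (hM : M.PosSemidef)
    (D : Matrix κ ι ℝ) : (Dᵀ * M * D).PosSemidef := by
  simpa using hM.conjTranspose_mul_mul_same D

theorem PosSemidef.mul_mul_transpose_same {M : Matrix κ κ ℝ} (hM : M.PosSemidef)
    (D : Matrix ι κ ℝ) : (D * M * Dᵀ).PosSemidef := by
  simpa using hM.mul_mul_conjTranspose_same D

variable [DecidableEq ι]

/-- Fenchel–Young inequality for a positive definite quadratic form. -/
theorem PosDef.two_mul_dotProduct_le {M : Matrix ι ι ℝ} (hM : M.PosDef) (x y : ι → ℝ) :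
    2 * (x ⬝ᵥ y) ≤ x ⬝ᵥ M *ᵥ x + y ⬝ᵥ M⁻¹ *ᵥ y := by
  have hu : IsUnit M.det := (isUnit_iff_isUnit_det M).mp hM.isUnit
  have h := hM.posSemidef.dotProduct_mulVec_nonneg (x - M⁻¹ *ᵥ y)
  have hxy := hM.isHermitian.dotProduct_mulVec_comm (M⁻¹ *ᵥ y) x
  simp only [star_trivial, mulVec_sub, sub_dotProduct, dotProduct_sub, hxy, mulVec_mulVec,
    mul_nonsing_inv _ hu, one_mulVec] at h
  rw [dotProduct_comm (M⁻¹ *ᵥ y) y] at h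
  linarith

/-- Inversion is antitone on positive definite matrices. -/
theorem PosDef.posSemidef_inv_sub_inv_s11 {M N : Matrix ι ι ℝ} (hM : M.PosDef) (hN : N.PosDef)
    (h : (N - M).PosSemidef) : (M⁻¹ - N⁻¹).PosSemidef := by
  refine .of_dotProduct_mulVec_nonneg (hM.inv.isHermitian.sub hN.inv.isHermitian) fun x => ?_
  have hu : IsUnit M.det := (isUnit_iff_isUnit_det M).mp hM.isUnit
  have hv : IsUnit N.det := (isUnit_iff_isUnit_det N).mp hN.isUnit
  have h₁ := hM.inv.two_mul_dotProduct_le x (N⁻¹ *ᵥ x)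
  have h₂ := h.dotProduct_mulVec_nonneg (N⁻¹ *ᵥ x)
  simp only [star_trivial, sub_mulVec, dotProduct_sub] at h₂ ⊢
  rw [mulVec_mulVec _ N, mul_nonsing_inv _ hv, one_mulVec, dotProduct_comm _ x] at h₂
  rw [nonsing_inv_nonsing_inv _ hu] at h₁
  linarith

/-- The information-form covariance is minimal among all gains `G`: a Joseph-form bound. -/
theorem PosDef.posSemidef_joseph_sub [DecidableEq κ] {X : Matrix ι ι ℝ} {R : Matrix κ κ ℝ} (hX : X.PosDef)
    (hR : R.PosDef) (A : Matrix ι ι ℝ) (D : Matrix κ ι ℝ) (G : Matrix ι κ ℝ) :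
    ((A - G * D) * X * (A - G * D)ᵀ + G * R * Gᵀ -
      A * (X⁻¹ + Dᵀ * R⁻¹ * D)⁻¹ * Aᵀ).PosSemidef := by
  have hN : (X⁻¹ + Dᵀ * R⁻¹ * D).PosDef :=
    hX.inv.add_posSemidef (hR.inv.posSemidef.transpose_mul_mul_same D)
  refine .of_dotProduct_mulVec_nonneg
    (((hX.posSemidef.mul_mul_transpose_same _).add
      (hR.posSemidef.mul_mul_transpose_same G)).isHermitian.sub
      (hN.inv.posSemidef.mul_mul_transpose_same A).isHermitian) fun v => ?_
  have hu : IsUnit (X⁻¹ + Dᵀ * R⁻¹ * D).det := (isUnit_iff_isUnit_det _).mp hN.isUnit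
  obtain ⟨w, hw⟩ : ∃ w, w = (X⁻¹ + Dᵀ * R⁻¹ * D)⁻¹ *ᵥ (Aᵀ *ᵥ v) := ⟨_, rfl⟩
  have hw' : (X⁻¹ + Dᵀ * R⁻¹ * D) *ᵥ w = Aᵀ *ᵥ v := by
    rw [hw, mulVec_mulVec, mul_nonsing_inv _ hu, one_mulVec]
  have h₁ := hX.two_mul_dotProduct_le ((A - G * D)ᵀ *ᵥ v) w
  have h₂ := hR.two_mul_dotProduct_le (Gᵀ *ᵥ v) (D *ᵥ w)
  have h₃ : ((A - G * D)ᵀ *ᵥ v) ⬝ᵥ w + (Gᵀ *ᵥ v) ⬝ᵥ (D *ᵥ w) = (Aᵀ *ᵥ v) ⬝ᵥ w := by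
    simp only [mulVec_transpose, dotProduct_mulVec, vecMul_sub, sub_dotProduct, vecMul_vecMul]
    ring
  have h₄ : w ⬝ᵥ X⁻¹ *ᵥ w + (D *ᵥ w) ⬝ᵥ R⁻¹ *ᵥ (D *ᵥ w) = (Aᵀ *ᵥ v) ⬝ᵥ w := by
    rw [← hw', add_mulVec, dotProduct_comm _ w, dotProduct_add, Matrix.mul_assoc, ← mulVec_mulVec,
      ← mulVec_mulVec, dotProduct_mulVec w Dᵀ, vecMul_transpose]
  simp only [star_trivial, sub_mulVec, add_mulVec, dotProduct_sub, dotProduct_add]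
  rw [dotProduct_mul_mul_transpose_mulVec, dotProduct_mul_mul_transpose_mulVec,
    dotProduct_mul_mul_transpose_mulVec, ← hw]
  linarith

theorem IsHermitian.posSemidef_sub_smul_one_of_le_sInf {M : Matrix ι ι ℝ} (hM : M.IsHermitian)
    {c : ℝ} (hc : c ≤ sInf (spectrum ℝ M)) : (M - c • 1).PosSemidef := by
  have hs : (M - c • 1).IsHermitian := hM.sub (by simp [IsHermitian])
  refine posSemidef_iff_isHermitian_and_spectrum_nonneg.mpr ⟨hs, fun r hr => ?_⟩
  rw [← Algebra.algebraMap_eq_smul_one, ← spectrum.sub_singleton_eq] at hr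
  obtain ⟨s, hsM, _, rfl, rfl⟩ := hr
  exact sub_nonneg.mpr (hc.trans (csInf_le M.finite_spectrum.bddBelow hsM))

end

end Matrix

theorem stmt_11 {n m : ℕ} (A Q : Matrix (Fin n) (Fin n) ℝ)
    (C : Matrix (Fin m) (Fin n) ℝ) (G : Matrix (Fin n) (Fin m) ℝ)
    (R : Matrix (Fin m) (Fin m) ℝ)
    (hQsym : Q.IsSymm) (hQ : Q.PosDef) (hRsym : R.IsSymm) (hR : R.PosDef)
    (α ρ : ℝ) (hα0 : 0 < α) (hα1 : α ≤ 1) (hρ : 1 < ρ)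
    (Sig : Matrix (Fin n) (Fin n) ℝ) (hSigsym : Sig.IsSymm) (hSig : Sig.PosDef)
    (hlyap : Sig = ρ ^ 2 • ((A - α • (G * C)) * Sig * (A - α • (G * C))ᵀ) + G * R * Gᵀ + Q)
    (β : ℝ)
    (hβ : β = lambdaMin (((ρ ^ 2 - 1) / ρ ^ 2) • Sig⁻¹ + (1 - α ^ 2) • (Cᵀ * R⁻¹ * C)))
    (θ : ℝ) (hθ0 : 0 ≤ θ) (hθβ : θ ≤ β)
    (P : ℕ → Matrix (Fin n) (Fin n) ℝ) (hPsym : ∀ t, (P t).IsSymm)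
    (hP0 : (P 0).PosDef) (hP0Sig : (Sig - P 0).PosSemidef)
    (hPrec : ∀ t, P (t + 1) = A * ((P t)⁻¹ + Cᵀ * R⁻¹ * C - θ • 1)⁻¹ * Aᵀ + Q) :
    ∀ t, (P t).PosDef ∧ (Sig - P t).PosSemidef ∧
      ((P t)⁻¹ + Cᵀ * R⁻¹ * C - θ • 1).PosDef := by
  have hρ2 : 0 < ρ ^ 2 := by positivity
  have hS : (Cᵀ * R⁻¹ * C).PosSemidef := hR.inv.posSemidef.transpose_mul_mul_same C
  have hX : (ρ ^ 2 • Sig).PosDef := hSig.smul hρ2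
  have hXinv : (ρ ^ 2 • Sig)⁻¹ = (ρ ^ 2)⁻¹ • Sig⁻¹ := by
    refine inv_eq_right_inv ?_
    rw [smul_mul_smul_comm, mul_inv_cancel₀ hρ2.ne',
      mul_nonsing_inv _ ((isUnit_iff_isUnit_det _).mp hSig.isUnit), one_smul]
  have hN : ((ρ ^ 2 • Sig)⁻¹ + (α • C)ᵀ * R⁻¹ * (α • C)).PosDef :=
    hX.inv.add_posSemidef (hR.inv.posSemidef.transpose_mul_mul_same _)
  have hH := IsHermitian.posSemidef_sub_smul_one_of_le_sInf
    (M := ((ρ ^ 2 - 1) / ρ ^ 2) • Sig⁻¹ + (1 - α ^ 2) • (Cᵀ * R⁻¹ * C))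
    ((hSig.inv.posSemidef.smul (div_nonneg (by nlinarith) hρ2.le)).add
      (hS.smul (by nlinarith))).isHermitian (hβ ▸ hθβ : θ ≤ lambdaMin _)
  have step : ∀ P : Matrix (Fin n) (Fin n) ℝ, P.PosDef → (Sig - P).PosSemidef →
      (P⁻¹ + Cᵀ * R⁻¹ * C - θ • 1 -
        ((ρ ^ 2 • Sig)⁻¹ + (α • C)ᵀ * R⁻¹ * (α • C))).PosSemidef := by
    intro P hP hPS
    convert (hP.posSemidef_inv_sub_inv_s11 hSig hPS).add hH using 1
    have e : (ρ ^ 2 - 1) / ρ ^ 2 = 1 - (ρ ^ 2)⁻¹ := by field_simp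
    rw [hXinv, e]
    simp only [transpose_smul, Matrix.smul_mul, Matrix.mul_smul]
    module
  have stepPos : ∀ P : Matrix (Fin n) (Fin n) ℝ, P.PosDef → (Sig - P).PosSemidef →
      (P⁻¹ + Cᵀ * R⁻¹ * C - θ • 1).PosDef := by
    intro P hP hPS
    simpa using hN.add_posSemidef (step P hP hPS)
  have main : ∀ t, (P t).PosDef ∧ (Sig - P t).PosSemidef := by
    intro t
    induction t with
    | zero => exact ⟨hP0, hP0Sig⟩
    | succ t ih =>
      have hM := stepPos _ ih.1 ih.2
      have h₁ := (hN.posSemidef_inv_sub_inv_s11 hM (step _ ih.1 ih.2)).mul_mul_transpose_same A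
      have h₂ := hX.posSemidef_joseph_sub hR A (α • C) G
      rw [hPrec t]
      refine ⟨hQ.posSemidef_add (hM.inv.posSemidef.mul_mul_transpose_same A), ?_⟩
      convert h₁.add h₂ using 1
      conv_lhs => rw [hlyap]
      simp only [Matrix.mul_sub, Matrix.sub_mul, Matrix.smul_mul, Matrix.mul_smul, smul_sub]
      abel
  exact fun t => ⟨(main t).1, (main t).2, stepPos _ (main t).1 (main t).2⟩
end

section
/- Let C ∈ ℝ^{m×n}, R ∈ ℝ^{m×m} symmetric positive definite, Σ ∈ ℝ^{n×n} symmetric positive definite, α ∈ (0, 1] and ρ > 1, and define β := λ_min(((ρ² − 1)/ρ²)·Σ⁻¹ + (1 − α²)·CᵀR⁻¹C). If 0 ≤ θ ≤ β and P is an n×n real symmetric positive definite matrix with P ⪯ Σ, then P⁻¹ + CᵀR⁻¹C − θI is positive definite. -/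
open Matrix

theorem posSemidef_sub_smul_one_of_le_lambdaMin {n : ℕ} {M : Matrix (Fin n) (Fin n) ℝ}
    (hM : M.IsHermitian) {θ : ℝ} (hθ : θ ≤ lambdaMin M) :
    (M - θ • (1 : Matrix (Fin n) (Fin n) ℝ)).PosSemidef := by
  rw [posSemidef_iff_isHermitian_and_spectrum_nonneg]
  refine ⟨hM.sub (isHermitian_one.smul (IsSelfAdjoint.all θ)), fun μ hμ ↦ ?_⟩
  rw [← Algebra.algebraMap_eq_smul_one, ← spectrum.sub_singleton_eq] at hμ
  obtain ⟨x, hx, rfl⟩ : ∃ x ∈ spectrum ℝ M, x - θ = μ := by simpa using hμ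
  exact sub_nonneg.2 (hθ.trans (csInf_le M.finite_real_spectrum.bddBelow hx))

theorem posSemidef_inv_sub_inv {n : Type*} [Fintype n] [DecidableEq n] {A B : Matrix n n ℝ}
    (hA : A.PosDef) (hB : B.PosDef) (hAB : (B - A).PosSemidef) : (A⁻¹ - B⁻¹).PosSemidef := by
  have := hB.isUnit.invertible
  have := hA.inv.isUnit.invertible
  have h : (fromBlocks B 1 (1 : Matrix n n ℝ)ᴴ A⁻¹).PosSemidef := by
    rw [PosDef.fromBlocks₂₂ _ _ hA.inv]
    simpa [nonsing_inv_nonsing_inv A ((isUnit_iff_isUnit_det A).1 hA.isUnit)] using hAB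
  rw [PosDef.fromBlocks₁₁ _ _ hB] at h
  simpa using h

theorem stmt_12 {n m : ℕ} (C : Matrix (Fin m) (Fin n) ℝ)
    (R : Matrix (Fin m) (Fin m) ℝ) (hRsym : R.IsSymm) (hR : R.PosDef)
    (Sig : Matrix (Fin n) (Fin n) ℝ) (hSigsym : Sig.IsSymm) (hSig : Sig.PosDef)
    (α ρ : ℝ) (hα0 : 0 < α) (hα1 : α ≤ 1) (hρ : 1 < ρ)
    (β : ℝ)
    (hβ : β = lambdaMin (((ρ ^ 2 - 1) / ρ ^ 2) • Sig⁻¹ + (1 - α ^ 2) • (Cᵀ * R⁻¹ * C)))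
    (θ : ℝ) (hθ0 : 0 ≤ θ) (hθβ : θ ≤ β)
    (P : Matrix (Fin n) (Fin n) ℝ) (hPsym : P.IsSymm) (hP : P.PosDef)
    (hPSig : (Sig - P).PosSemidef) :
    (P⁻¹ + Cᵀ * R⁻¹ * C - θ • 1).PosDef := by
  have hC : (Cᵀ * R⁻¹ * C).PosSemidef := by
    simpa using hR.inv.posSemidef.conjTranspose_mul_mul_same C
  have hM := posSemidef_sub_smul_one_of_le_lambdaMin
    ((hSig.inv.isHermitian.smul (IsSelfAdjoint.all ((ρ ^ 2 - 1) / ρ ^ 2))).add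
      (hC.isHermitian.smul (IsSelfAdjoint.all (1 - α ^ 2)))) (hθβ.trans_eq hβ)
  have hρ0 : ρ ≠ 0 := by positivity
  have hSig' : ((1 / ρ ^ 2) • Sig⁻¹).PosDef := hSig.inv.smul (by positivity)
  have hC' : (α ^ 2 • (Cᵀ * R⁻¹ * C)).PosSemidef := hC.smul (by positivity)
  have hsum := ((hSig'.add_posSemidef (posSemidef_inv_sub_inv hP hSig hPSig)).add_posSemidef
    hC').add_posSemidef hM
  convert hsum using 1
  have hcoef : (ρ ^ 2 - 1) / ρ ^ 2 = 1 - 1 / ρ ^ 2 := by field_simp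
  rw [hcoef]
  module
end

section
/- Let A ∈ ℝ^{n×n}, C ∈ ℝ^{m×n}, G ∈ ℝ^{n×m}, R ∈ ℝ^{m×m} symmetric positive definite, α, θ ∈ ℝ, and let P ∈ ℝ^{n×n} be symmetric positive definite such that S := P⁻¹ + (1 − α²)·CᵀR⁻¹C − θI is positive definite. Define Φ := α²·C S⁻¹ Cᵀ + R and X := α(A − αGC) S⁻¹ Cᵀ − GR. Then P⁻¹ + CᵀR⁻¹C − θI = S + α²·CᵀR⁻¹C is positive definite, Φ is positive definite, and A(P⁻¹ + CᵀR⁻¹C − θI)⁻¹Aᵀ = (A − αGC) S⁻¹ (A − αGC)ᵀ − X Φ⁻¹ Xᵀ + G R Gᵀ. -/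
open Matrix

/-- Decomposition of `A (S + Hᵀ R⁻¹ H)⁻¹ Aᵀ` along an arbitrary gain `G`. -/
theorem Matrix.mul_add_mul_inv_mul_inv_mul_transpose_eq {m n k 𝕜 : Type*} [Fintype m]
    [DecidableEq m] [Fintype n] [DecidableEq n] [CommRing 𝕜]
    (A : Matrix k n 𝕜) (H : Matrix m n 𝕜) (G : Matrix k m 𝕜)
    {R Φ : Matrix m m 𝕜} {S : Matrix n n 𝕜} (hRsym : R.IsSymm) (hSsym : S.IsSymm)
    (hR : IsUnit R) (hS : IsUnit S) (hΦ : Φ = H * S⁻¹ * Hᵀ + R) (hΦu : IsUnit Φ) :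
    A * (S + Hᵀ * R⁻¹ * H)⁻¹ * Aᵀ
      = (A - G * H) * S⁻¹ * (A - G * H)ᵀ
        - ((A - G * H) * S⁻¹ * Hᵀ - G * R) * Φ⁻¹ * ((A - G * H) * S⁻¹ * Hᵀ - G * R)ᵀ
        + G * R * Gᵀ := by
  have hRR : R⁻¹⁻¹ = R := nonsing_inv_nonsing_inv R ((isUnit_iff_isUnit_det R).1 hR)
  have hdet : IsUnit Φ.det := (isUnit_iff_isUnit_det Φ).1 hΦu
  have hST : (S⁻¹)ᵀ = S⁻¹ := by rw [transpose_nonsing_inv, hSsym.eq]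
  have hΦT : Φᵀ = Φ := by
    rw [hΦ]
    simp only [transpose_add, transpose_mul, transpose_transpose, hST, hRsym.eq, Matrix.mul_assoc]
  have hΦ' : R⁻¹⁻¹ + H * S⁻¹ * Hᵀ = Φ := by rw [hRR, hΦ, add_comm]
  have hX : (A - G * H) * S⁻¹ * Hᵀ - G * R = A * S⁻¹ * Hᵀ - G * Φ := by
    rw [hΦ]
    simp only [Matrix.sub_mul, Matrix.mul_add, Matrix.mul_assoc]
    abel
  have hXT : (A * S⁻¹ * Hᵀ - G * Φ)ᵀ = H * S⁻¹ * Aᵀ - Φ * Gᵀ := by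
    simp only [transpose_sub, transpose_mul, transpose_transpose, hST, hΦT, Matrix.mul_assoc]
  have hquad : (A * S⁻¹ * Hᵀ - G * Φ) * Φ⁻¹ * (H * S⁻¹ * Aᵀ - Φ * Gᵀ)
      = A * S⁻¹ * Hᵀ * Φ⁻¹ * (H * S⁻¹ * Aᵀ) - A * S⁻¹ * Hᵀ * Gᵀ
        - G * (H * S⁻¹ * Aᵀ) + G * Φ * Gᵀ := by
    rw [Matrix.sub_mul, mul_nonsing_inv_cancel_right _ _ hdet, Matrix.sub_mul, Matrix.mul_sub,
      Matrix.mul_sub, ← Matrix.mul_assoc (A * S⁻¹ * Hᵀ * Φ⁻¹) Φ,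
      nonsing_inv_mul_cancel_right _ _ hdet, ← Matrix.mul_assoc G Φ]
    abel
  rw [add_mul_mul_inv_eq_sub S Hᵀ R⁻¹ H hS ((isUnit_nonsing_inv_iff).2 hR) (hΦ' ▸ hΦu),
    hΦ', hX, hXT, hquad, hΦ]
  simp only [Matrix.sub_mul, Matrix.mul_sub, Matrix.add_mul, Matrix.mul_add, transpose_sub,
    transpose_mul, Matrix.mul_assoc]
  abel

theorem stmt_19 {n m : ℕ} (A : Matrix (Fin n) (Fin n) ℝ)
    (C : Matrix (Fin m) (Fin n) ℝ) (G : Matrix (Fin n) (Fin m) ℝ)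
    (R : Matrix (Fin m) (Fin m) ℝ) (hRsym : R.IsSymm) (hR : R.PosDef)
    (α θ : ℝ)
    (P : Matrix (Fin n) (Fin n) ℝ) (hPsym : P.IsSymm) (hP : P.PosDef)
    (S : Matrix (Fin n) (Fin n) ℝ)
    (hS : S = P⁻¹ + (1 - α ^ 2) • (Cᵀ * R⁻¹ * C) - θ • 1)
    (hSpd : S.PosDef)
    (Φ : Matrix (Fin m) (Fin m) ℝ)
    (hΦ : Φ = α ^ 2 • (C * S⁻¹ * Cᵀ) + R)
    (X : Matrix (Fin n) (Fin m) ℝ)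
    (hX : X = α • ((A - α • (G * C)) * S⁻¹ * Cᵀ) - G * R) :
    P⁻¹ + Cᵀ * R⁻¹ * C - θ • 1 = S + α ^ 2 • (Cᵀ * R⁻¹ * C) ∧
    (P⁻¹ + Cᵀ * R⁻¹ * C - θ • 1).PosDef ∧
    Φ.PosDef ∧
    A * (P⁻¹ + Cᵀ * R⁻¹ * C - θ • 1)⁻¹ * Aᵀ
      = (A - α • (G * C)) * S⁻¹ * (A - α • (G * C))ᵀ - X * Φ⁻¹ * Xᵀ + G * R * Gᵀ := by
  have hsum : P⁻¹ + Cᵀ * R⁻¹ * C - θ • 1 = S + α ^ 2 • (Cᵀ * R⁻¹ * C) := by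
    rw [hS, sub_smul, one_smul]
    abel
  have hpsd : (α ^ 2 • (Cᵀ * R⁻¹ * C)).PosSemidef := by
    simpa using (hR.inv.posSemidef.conjTranspose_mul_mul_same C).smul (sq_nonneg α)
  have hΦpd : Φ.PosDef := by
    rw [hΦ]
    have h : (α ^ 2 • (C * S⁻¹ * Cᵀ)).PosSemidef := by
      simpa using (hSpd.inv.posSemidef.mul_mul_conjTranspose_same C).smul (sq_nonneg α)
    exact PosDef.posSemidef_add h hR
  refine ⟨hsum, hsum ▸ hSpd.add_posSemidef hpsd, hΦpd, ?_⟩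
  have hSsym : S.IsSymm := by simpa using hSpd.isHermitian
  have key := mul_add_mul_inv_mul_inv_mul_transpose_eq A (α • C) G hRsym hSsym hR.isUnit
    hSpd.isUnit (Φ := Φ) (by simp [hΦ, smul_smul, sq]) hΦpd.isUnit
  rw [hsum, hX]
  simpa [smul_smul, ← sq] using key
end
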